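/- (Validity of CopulaCPTS, fixed-threshold variant.) Let n ≥ 1, α ∈ (0,1), k ≥ 1, d ≥ 1, let 𝒳 be a measurable space, and let (X_1, Y_1), …, (X_{n+1}, Y_{n+1}) be exchangeable random pairs with values in 𝒳 × (ℝ^d)^k. Fix a measurable forecaster f : 𝒳 → (ℝ^d)^k, and define per-step nonconformity scores S_{i,j} := ‖Y_{i,j} − f(X_i)_j‖ (Euclidean norm) for j ∈ {1, …, k}. Fix nondecreasing functions F̂_1, …, F̂_k : ℝ → [0,1] (e.g. empirical CDFs estimated from an independent calibration split), and set u_{i,j} := F̂_j(S_{i,j}). Let q := Q(1−α, { max_{1 ≤ j ≤ k} u_{i,j} : 1 ≤ i ≤ n } ∪ {+∞}), let s*_j := sup { s ∈ ℝ : F̂_j(s) ≤ q } ∈ ℝ ∪ {±∞}, and define the confidence regions Γ^{1−α}_j := { y ∈ ℝ^d : ‖y − f(X_{n+1})_j‖ ≤ s*_j }. Then P[ Y_{n+1, j} ∈ Γ^{1−α}_j for all j ∈ {1, …, k} ] ≥ 1−α. -/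

import Mathlib

open MeasureTheory

/-- The empirical `(1-α)`-quantile of a finite multiset of extended reals. -/
noncomputable def empQuantile (α : ℝ) (S : Multiset EReal) : EReal :=
  sInf {q : EReal | 1 - α ≤ ((S.filter (fun s => s ≤ q)).card : ℝ) / (S.card : ℝ)}

/-- The number of coordinates of `v` lying strictly below the coordinate `v i`. -/
noncomputable def strictRank {ι : Type*} [Fintype ι] (v : ι → ℝ) (i : ι) : ℕ :=
  (Finset.univ.filter fun l => v l < v i).card

theorem strictRank_comp_perm {ι : Type*} [Fintype ι] (v : ι → ℝ) (σ : Equiv.Perm ι) (i : ι) :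
    strictRank (fun l => v (σ l)) i = strictRank v (σ i) := by
  unfold strictRank
  refine Finset.card_bij (fun l _ => σ l) ?_ (fun _ _ _ _ h => σ.injective h) ?_
  · intro l hl
    simpa using hl
  · intro l hl
    exact ⟨σ.symm l, by simpa using hl, by simp⟩

theorem measurable_strictRank {ι : Type*} [Fintype ι] (i : ι) :
    Measurable fun v : ι → ℝ => strictRank v i := by
  unfold strictRank
  simp only [Finset.card_filter]
  refine Finset.measurable_sum _ fun l _ => Measurable.ite ?_ measurable_const measurable_const
  exact measurableSet_lt (measurable_pi_apply l) (measurable_pi_apply i)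

/-- At least `c` coordinates have strict rank below `c`, provided there are at least `c`
coordinates. -/
theorem le_card_strictRank_lt {ι : Type*} [Fintype ι] (v : ι → ℝ) {c : ℝ}
    (hc : c ≤ Fintype.card ι) :
    c ≤ ((Finset.univ.filter fun i => (strictRank v i : ℝ) < c).card : ℝ) := by
  classical
  rcases (Finset.univ.filter fun i => ¬ (strictRank v i : ℝ) < c).eq_empty_or_nonempty with h | h
  · rw [Finset.filter_eq_empty_iff] at h
    rw [Finset.filter_true_of_mem fun i hi => not_not.1 (h hi)]
    simpa using hc
  · obtain ⟨i, hi, hmin⟩ := Finset.exists_min_image _ v h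
    simp only [Finset.mem_filter, Finset.mem_univ, true_and] at hi hmin
    refine (not_lt.1 hi).trans (Nat.cast_le.2 (Finset.card_le_card fun l hl => ?_))
    simp only [Finset.mem_filter, Finset.mem_univ, true_and] at hl ⊢
    by_contra hl'
    exact (hmin l hl').not_gt hl

/-- A real number with few coordinates strictly below it lies below the empirical quantile. -/
theorem le_empQuantile_of_strictRank_lt {n : ℕ} {α : ℝ} (v : Fin (n + 1) → ℝ)
    (h : (strictRank v (Fin.last n) : ℝ) < (1 - α) * (n + 1)) :
    (v (Fin.last n) : EReal) ≤
      empQuantile α ((Finset.univ.val.map fun i : Fin n => (v i.castSucc : EReal)) + {⊤}) := by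
  refine le_sInf fun q hq => ?_
  by_contra hlt
  rw [not_le] at hlt
  have htop : ¬ (⊤ : EReal) ≤ q := not_le.2 (hlt.trans_le le_top)
  simp only [Set.mem_ofPred_eq, Multiset.filter_add, Multiset.filter_singleton, htop, if_false,
    Multiset.filter_map, Multiset.card_add, Multiset.card_map, Multiset.card_singleton,
    Multiset.empty_eq_zero, Multiset.card_zero, add_zero, Finset.card_val, Finset.card_univ,
    Fintype.card_fin] at hq
  rw [le_div_iff₀ (by positivity)] at hq
  push_cast at hq
  refine absurd (hq.trans_lt' h) (not_lt.2 (Nat.cast_le.2 ?_))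
  change (Finset.univ.filter fun i : Fin n => (v i.castSucc : EReal) ≤ q).card ≤ _
  refine Finset.card_le_card_of_injOn Fin.castSucc (fun i hi => ?_)
    (Fin.castSucc_injective n).injOn
  simp only [Finset.coe_filter, Finset.mem_univ, true_and, Set.mem_ofPred_eq] at hi ⊢
  exact EReal.coe_lt_coe_iff.1 (hi.trans_lt hlt)

/-- If `V` is exchangeable, each coordinate has strict rank below `p * card ι` with probability at
least `p`. -/
theorem ofReal_le_measure_strictRank_lt {Ω ι : Type*} [MeasurableSpace Ω] [Fintype ι]
    (P : Measure Ω) [IsProbabilityMeasure P] (V : ι → Ω → ℝ) (hV : ∀ i, Measurable (V i))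
    (hexch : ∀ σ : Equiv.Perm ι,
      Measure.map (fun ω i => V (σ i) ω) P = Measure.map (fun ω i => V i ω) P)
    {p : ℝ} (hp : p ≤ 1) (i : ι) :
    ENNReal.ofReal p ≤
      P {ω | (strictRank (fun l => V l ω) i : ℝ) < p * Fintype.card ι} := by
  classical
  set c : ℝ := p * Fintype.card ι with hc
  have hD (l : ι) : MeasurableSet {v : ι → ℝ | (strictRank v l : ℝ) < c} :=
    measurableSet_lt (measurable_from_top.comp (measurable_strictRank l)) measurable_const
  have hmeas (l : ι) : MeasurableSet {ω | (strictRank (fun m => V m ω) l : ℝ) < c} :=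
    (measurable_pi_lambda _ hV) (hD l)
  have heq (l : ι) : P {ω | (strictRank (fun m => V m ω) l : ℝ) < c} =
      P {ω | (strictRank (fun m => V m ω) i : ℝ) < c} := by
    have h := congrArg (fun μ => μ {v : ι → ℝ | (strictRank v i : ℝ) < c})
      (hexch (Equiv.swap i l))
    rw [Measure.map_apply (measurable_pi_lambda _ fun m => hV _) (hD i),
      Measure.map_apply (measurable_pi_lambda _ hV) (hD i)] at h
    simp only [Set.preimage_ofPred_eq] at h
    rw [← h]
    congr 1
    ext ω
    simp only [Set.mem_ofPred_eq]
    rw [strictRank_comp_perm (fun m => V m ω), Equiv.swap_apply_left]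
  have hsum : ENNReal.ofReal c ≤
      ∑ l, P {ω | (strictRank (fun m => V m ω) l : ℝ) < c} := by
    calc ENNReal.ofReal c = ∫⁻ _, ENNReal.ofReal c ∂P := by simp
      _ ≤ ∫⁻ ω, ∑ l, {ω | (strictRank (fun m => V m ω) l : ℝ) < c}.indicator 1 ω ∂P := by
        refine lintegral_mono fun ω => ?_
        have h := le_card_strictRank_lt (fun m => V m ω) (c := c)
          (mul_le_of_le_one_left (Nat.cast_nonneg _) hp)
        refine (ENNReal.ofReal_le_ofReal h).trans_eq ?_
        simp [Set.indicator_apply]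
      _ = _ := by
        rw [lintegral_finsetSum _ fun l _ => measurable_one.indicator (hmeas l)]
        exact Finset.sum_congr rfl fun l _ => lintegral_indicator_one (hmeas l)
  simp only [heq, Finset.sum_const, Finset.card_univ, nsmul_eq_mul] at hsum
  rw [show ENNReal.ofReal c = Fintype.card ι * ENNReal.ofReal p by
    rw [hc, mul_comm, ENNReal.ofReal_mul (Nat.cast_nonneg _), ENNReal.ofReal_natCast]] at hsum
  have : Nonempty ι := ⟨i⟩
  exact (ENNReal.mul_le_mul_iff_right (Nat.cast_ne_zero.2 Fintype.card_ne_zero)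
    (ENNReal.natCast_ne_top _)).1 hsum

/-- Validity of CopulaCPTS (fixed-threshold variant): for exchangeable pairs
`(X_i, Y_i)` with `Y_i ∈ (ℝ^d)^k`, a fixed measurable forecaster `f`, per-step
scores `S_{i,j} = ‖Y_{i,j} - f(X_i)_j‖`, fixed nondecreasing `F̂_j : ℝ → [0,1]`,
`u_{i,j} = F̂_j(S_{i,j})`, `q := Q(1-α, {max_j u_{i,j} : i ≤ n} ∪ {+∞})` and
`s*_j := sup { s : F̂_j(s) ≤ q }`, the confidence balls
`Γ_j := {y : ‖y - f(X_{n+1})_j‖ ≤ s*_j}` jointly cover `Y_{n+1}` with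
probability at least `1-α`. -/
theorem stmt_9 {Ω : Type*} [MeasurableSpace Ω] (P : Measure Ω) [IsProbabilityMeasure P]
    {𝒳 : Type*} [MeasurableSpace 𝒳]
    (n k d : ℕ) (hn : 1 ≤ n) (hk : 1 ≤ k) (hd : 1 ≤ d)
    (α : ℝ) (hα : α ∈ Set.Ioo (0 : ℝ) 1)
    (X : Fin (n + 1) → Ω → 𝒳) (Y : Fin (n + 1) → Ω → (Fin k → EuclideanSpace ℝ (Fin d)))
    (hX : ∀ i, Measurable (X i)) (hY : ∀ i, Measurable (Y i))
    (hexch : ∀ σ : Equiv.Perm (Fin (n + 1)),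
      Measure.map (fun ω => fun i => (X (σ i) ω, Y (σ i) ω)) P =
        Measure.map (fun ω => fun i => (X i ω, Y i ω)) P)
    (f : 𝒳 → (Fin k → EuclideanSpace ℝ (Fin d))) (hf : Measurable f)
    (F : Fin k → ℝ → ℝ) (hFmono : ∀ j, Monotone (F j))
    (hFrange : ∀ j s, F j s ∈ Set.Icc (0 : ℝ) 1) :
    ENNReal.ofReal (1 - α) ≤
      P {ω | ∀ j : Fin k,
        (‖Y (Fin.last n) ω j - f (X (Fin.last n) ω) j‖ : EReal) ≤
          sSup ((fun r : ℝ => (r : EReal)) ''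
            {r : ℝ | ((F j r : ℝ) : EReal) ≤
              empQuantile α
                ((Finset.univ.val.map fun i : Fin n =>
                  ((Finset.univ.sup' (Finset.univ_nonempty_iff.mpr ⟨⟨0, hk⟩⟩)
                    (fun j' : Fin k =>
                      F j' ‖Y i.castSucc ω j' - f (X i.castSucc ω) j'‖) : ℝ) : EReal))
                  + {⊤})})} := by
  have hne : (Finset.univ : Finset (Fin k)).Nonempty := Finset.univ_nonempty_iff.mpr ⟨⟨0, hk⟩⟩
  set g : 𝒳 × (Fin k → EuclideanSpace ℝ (Fin d)) → ℝ := fun z =>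
    Finset.univ.sup' hne fun j => F j ‖z.2 j - f z.1 j‖ with hg_def
  have hg : Measurable g := by
    have h : Measurable (Finset.univ.sup' hne fun j
        (z : 𝒳 × (Fin k → EuclideanSpace ℝ (Fin d))) => F j ‖z.2 j - f z.1 j‖) :=
      Finset.measurable_sup' hne fun j _ => (hFmono j).measurable.comp
        (((measurable_pi_apply j).comp measurable_snd).sub
          ((measurable_pi_apply j).comp (hf.comp measurable_fst))).norm
    convert h using 1
    ext z
    simp [hg_def, Finset.sup'_apply]
  have hZ (i : Fin (n + 1)) : Measurable fun ω => (X i ω, Y i ω) := (hX i).prodMk (hY i)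
  have hexchV (σ : Equiv.Perm (Fin (n + 1))) :
      Measure.map (fun ω i => g (X (σ i) ω, Y (σ i) ω)) P =
        Measure.map (fun ω i => g (X i ω, Y i ω)) P := by
    have hG : Measurable fun (z : Fin (n + 1) → 𝒳 × (Fin k → EuclideanSpace ℝ (Fin d))) i =>
        g (z i) := measurable_pi_lambda _ fun i => hg.comp (measurable_pi_apply i)
    have h := congrArg (Measure.map fun z i => g (z i)) (hexch σ)
    rwa [Measure.map_map hG (measurable_pi_lambda _ fun i => hZ _),
      Measure.map_map hG (measurable_pi_lambda _ hZ)] at h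
  refine (ofReal_le_measure_strictRank_lt P (fun i ω => g (X i ω, Y i ω))
    (fun i => hg.comp (hZ i)) hexchV (sub_le_self 1 hα.1.le) (Fin.last n)).trans
    (measure_mono fun ω hω j => ?_)
  have hq := le_empQuantile_of_strictRank_lt (α := α) (fun i => g (X i ω, Y i ω))
    (by simpa using hω)
  refine le_sSup ⟨_, le_trans (EReal.coe_le_coe_iff.2 ?_) hq, rfl⟩
  exact Finset.le_sup' (fun j => F j ‖Y (Fin.last n) ω j - f (X (Fin.last n) ω) j‖)
    (Finset.mem_univ j)
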